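/- Let l ≥ 1, r : Fin l → ℝ, w : Fin l → {0,1} a binary indicator vector whose selected set S = {i : w_i = 1} is nonempty, and take ε = 0. Suppose β > 0 and h > 0 satisfy h·e^{βh} > (l−1)·e^{−1}/β, and suppose max_j (−r_j w_j) ≠ 0. Define the minimum approximation r̃_min = −F(−r,β,h,w). Then min_{i∈S} r_i < 0 if and only if r̃_min < 0, and min_{i∈S} r_i > 0 if and only if r̃_min > 0. -/

import Mathlib

/-- The sparse softmax function `F(r, β, h, w)`: with `r'_i = r_i * w_i`,
`r''_i = h * r'_i / (|max_j r'_j| + ε)` and `q_i = exp (β * r''_i) / ∑_j exp (β * r''_j)`,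
it is `(∑_i r_i * w_i * q_i) / (∑_i w_i * q_i)`. -/
noncomputable def sparseSoftmax {l : ℕ} (r : Fin l → ℝ) (β h ε : ℝ) (w : Fin l → ℝ) : ℝ :=
  let r' : Fin l → ℝ := fun i => r i * w i
  let m : ℝ := ⨆ i, r' i
  let r'' : Fin l → ℝ := fun i => h * r' i / (|m| + ε)
  let q : Fin l → ℝ := fun i => Real.exp (β * r'' i) / ∑ j, Real.exp (β * r'' j)
  (∑ i, r i * w i * q i) / (∑ i, w i * q i)

theorem Real.neg_exp_neg_one_le_mul_exp (t : ℝ) : -Real.exp (-1) ≤ t * Real.exp t := by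
  have h : -t * Real.exp t ≤ Real.exp (-t - 1) * Real.exp t :=
    mul_le_mul_of_nonneg_right (by linarith [Real.add_one_le_exp (-t - 1)]) (Real.exp_pos t).le
  rw [← Real.exp_add, show -t - 1 + t = -1 by ring] at h
  linarith

/-- The normalization of the softmax weights cancels. -/
theorem sparseSoftmax_eq_div {l : ℕ} (r : Fin l → ℝ) (β h ε : ℝ) (w : Fin l → ℝ) :
    sparseSoftmax r β h ε w =
      (∑ i, r i * w i * Real.exp (β * (h * (r i * w i) / (|⨆ j, r j * w j| + ε)))) /
        ∑ i, w i * Real.exp (β * (h * (r i * w i) / (|⨆ j, r j * w j| + ε))) := by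
  rcases isEmpty_or_nonempty (Fin l) with _ | _
  · simp [sparseSoftmax]
  · simp only [sparseSoftmax, ← mul_div_assoc, ← Finset.sum_div]
    exact div_div_div_cancel_right₀
      (Finset.sum_pos (fun i _ => Real.exp_pos _) Finset.univ_nonempty).ne' _ _

theorem sum_mul_exp_pos {l : ℕ} (w : Fin l → ℝ) (hw : ∀ i, w i = 0 ∨ w i = 1)
    (hS : ∃ i, w i = 1) (f : Fin l → ℝ) : 0 < ∑ i, w i * Real.exp (f i) := by
  obtain ⟨k, hk⟩ := hS
  refine Finset.sum_pos' (fun i _ => mul_nonneg ?_ (Real.exp_pos _).le)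
    ⟨k, Finset.mem_univ k, by rw [hk, one_mul]; exact Real.exp_pos _⟩
  rcases hw i with h | h <;> simp [h]

theorem sparseSoftmax_pos {l : ℕ} (r w : Fin l → ℝ) (hw : ∀ i, w i = 0 ∨ w i = 1)
    (hS : ∃ i, w i = 1) {β h : ℝ} (hβ : 0 < β) (hh : 0 < h)
    (hcond : ((l : ℝ) - 1) * Real.exp (-1) / β < h * Real.exp (β * h))
    (hm : 0 < ⨆ j, r j * w j) : 0 < sparseSoftmax r β h 0 w := by
  rw [sparseSoftmax_eq_div]
  refine div_pos ?_ (sum_mul_exp_pos w hw hS _)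
  have : Nonempty (Fin l) := ⟨hS.choose⟩
  obtain ⟨k, hk⟩ := exists_eq_ciSup_of_finite (f := fun j => r j * w j)
  set m := ⨆ j, r j * w j
  rw [abs_of_pos hm, add_zero]
  have hβh : 0 < β * h := mul_pos hβ hh
  have hterm (i : Fin l) : -(m * Real.exp (-1) / (β * h)) ≤
      r i * w i * Real.exp (β * (h * (r i * w i) / m)) := by
    have key := mul_le_mul_of_nonneg_left
      (Real.neg_exp_neg_one_le_mul_exp (β * (h * (r i * w i) / m))) (div_pos hm hβh).le
    have e₁ : m / (β * h) * -Real.exp (-1) = -(m * Real.exp (-1) / (β * h)) := by ring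
    have e₂ (x : ℝ) : m / (β * h) * (β * (h * (r i * w i) / m) * x) = r i * w i * x := by
      field_simp
    rwa [e₁, e₂] at key
  have hsum : -((l - 1) * (m * Real.exp (-1) / (β * h))) ≤
      ∑ i ∈ Finset.univ.erase k, r i * w i * Real.exp (β * (h * (r i * w i) / m)) := by
    have := Finset.card_nsmul_le_sum (Finset.univ.erase k) _ _ (fun i _ => hterm i)
    rw [Finset.card_erase_of_mem (Finset.mem_univ k), Finset.card_univ, Fintype.card_fin,
      nsmul_eq_mul, Nat.cast_pred k.pos] at this
    linarith
  rw [← Finset.add_sum_erase _ _ (Finset.mem_univ k), hk, mul_div_cancel_right₀ _ hm.ne']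
  have hlead := mul_lt_mul_of_pos_left hcond (div_pos hm hh)
  have e₁ : m / h * (h * Real.exp (β * h)) = m * Real.exp (β * h) := by field_simp
  have e₂ : m / h * (((l : ℝ) - 1) * Real.exp (-1) / β) =
      (l - 1) * (m * Real.exp (-1) / (β * h)) := by field_simp
  linarith

theorem sparseSoftmax_neg {l : ℕ} (r w : Fin l → ℝ) (hw : ∀ i, w i = 0 ∨ w i = 1)
    (hS : ∃ i, w i = 1) (β h ε : ℝ) (hneg : ∀ i, r i * w i < 0) :
    sparseSoftmax r β h ε w < 0 := by
  rw [sparseSoftmax_eq_div]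
  exact div_neg_of_neg_of_pos
    (Finset.sum_neg (fun i _ => mul_neg_of_neg_of_pos (hneg i) (Real.exp_pos _))
      ⟨hS.choose, Finset.mem_univ _⟩)
    (sum_mul_exp_pos w hw hS _)

/-- The minimum part of Proposition 1 (cases (s3), (s4)): with `ε = 0`, `β > 0`, `h > 0`
satisfying `h * exp (β * h) > (l - 1) * exp (-1) / β`, and `max_j (-r_j * w_j) ≠ 0`, the
minimum approximation `r̃_min = -F(-r, β, h, w)` has the same strict sign as the minimum
of the selected entries. -/
theorem sparseSoftmax_sound_min (l : ℕ) (hl : 1 ≤ l)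
    (r : Fin l → ℝ) (w : Fin l → ℝ) (hw : ∀ i, w i = 0 ∨ w i = 1)
    (hS : ∃ i, w i = 1) (β h : ℝ) (hβ : 0 < β) (hh : 0 < h)
    (hcond : h * Real.exp (β * h) > ((l : ℝ) - 1) * Real.exp (-1) / β)
    (hne : (⨆ j, -r j * w j) ≠ 0) :
    (sInf (r '' {i | w i = 1}) < 0 ↔ -sparseSoftmax (fun i => -r i) β h 0 w < 0) ∧
      (0 < sInf (r '' {i | w i = 1}) ↔ 0 < -sparseSoftmax (fun i => -r i) β h 0 w) := by
  have hnonempty : (r '' {i | w i = 1}).Nonempty := Set.Nonempty.image r hS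
  have hfin : (r '' {i | w i = 1}).Finite := Set.toFinite _
  have : Nonempty (Fin l) := ⟨hS.choose⟩
  rcases hne.lt_or_gt with hm | hm
  · have hneg (i : Fin l) : -r i * w i < 0 :=
      (le_ciSup (f := fun j => -r j * w j) (Set.finite_range _).bddAbove i).trans_lt hm
    have hF := sparseSoftmax_neg (fun i => -r i) w hw hS β h 0 hneg
    have hmin : 0 < sInf (r '' {i | w i = 1}) := by
      obtain ⟨i, hi, heq⟩ := hnonempty.csInf_mem hfin
      have := hneg i
      rw [show w i = 1 from hi] at this
      linarith
    constructor <;> constructor <;> intro <;> linarith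
  · have hF := sparseSoftmax_pos (fun i => -r i) w hw hS hβ hh hcond hm
    have hmin : sInf (r '' {i | w i = 1}) < 0 := by
      obtain ⟨k, hk⟩ := exists_eq_ciSup_of_finite (f := fun j => -r j * w j)
      rw [← hk] at hm
      rcases hw k with h0 | h1
      · simp [h0] at hm
      · have hle := csInf_le hfin.bddBelow (Set.mem_image_of_mem r (show k ∈ {i | w i = 1} from h1))
        rw [h1] at hm
        linarith
    constructor <;> constructor <;> intro <;> linarith
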